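/- arXiv:2008.00721 — 2 statements merged into one kernel-verified Lean document; each statement's English description precedes it below -/
import Mathlib

section
/- For every $d\ge 1$ and every $I=(I_1,\dots,I_d)\in\mathcal{I}_d$ one has, in $A$, $\omega_I=\frac{1}{d}\sum_{j=1}^d(-1)^{j-1}\,d_{I_j}\,\omega_{(I_1,\dots,\widehat{I_j},\dots,I_d)}$, where $(I_1,\dots,\widehat{I_j},\dots,I_d)\in\mathcal{I}_{d-1}$ is the tuple obtained from $I$ by deleting the $j$-th entry. -/
open scoped Classical

noncomputable section
/-- The complementary index `t_{ijkl}`: the unique element of `Fin 5` not among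
distinct `i,j,k,l` (garbage value otherwise, where `eps` vanishes anyway). -/
def tIdx (i j k l : Fin 5) : Fin 5 :=
  ⟨(10 - (i.val + j.val + k.val + l.val)) % 5, Nat.mod_lt _ (by norm_num)⟩

/-- The sign `ε_{ijkl}`: the sign of the permutation `(i,j,k,l,t_{ijkl})` of `Fin 5`
if `i,j,k,l` are pairwise distinct, and `0` otherwise (Levi-Civita formula). -/
def eps (i j k l : Fin 5) : ℤ :=
  ∏ q : Fin 5, ∏ p ∈ Finset.univ.filter (fun p => p < q),
    Int.sign ((![(i.val : ℤ), (j.val : ℤ), (k.val : ℤ), (l.val : ℤ), ((tIdx i j k l).val : ℤ)]) q -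
      (![(i.val : ℤ), (j.val : ℤ), (k.val : ℤ), (l.val : ℤ), ((tIdx i j k l).val : ℤ)]) p)

/-- A unital associative `ℂ`-algebra `A` together with elements `d i j` and `∂ t`
satisfying the defining relations of `U_- = U(g_{-1} ⊕ g_{-2})` for `E(5,10)`. -/
structure E510Rep (A : Type*) [Ring A] [Algebra ℂ A] where
  d : Fin 5 → Fin 5 → A
  p : Fin 5 → A
  d_antisymm : ∀ i j, d i j = - d j i
  pd_comm : ∀ t i j, p t * d i j = d i j * p t
  pp_comm : ∀ s t, p s * p t = p t * p s
  dd_rel : ∀ i j k l, d i j * d k l + d k l * d i j = eps i j k l • p (tIdx i j k l)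

/-- Self-intersection free families of position pairs (each pair recorded as an
ordered pair `(k,l)` with `k < l`; the pairs are pairwise disjoint). -/
def isSIF {n : ℕ} (S : Finset (Fin n × Fin n)) : Prop :=
  (∀ q ∈ S, q.1 < q.2) ∧
    ∀ q ∈ S, ∀ q' ∈ S, q ≠ q' → q.1 ≠ q'.1 ∧ q.1 ≠ q'.2 ∧ q.2 ≠ q'.1 ∧ q.2 ≠ q'.2

/-- Two disjoint pairs cross if exactly one member of one lies strictly between
the members of the other. -/
def crosses {n : ℕ} (q q' : Fin n × Fin n) : Prop :=
  (q.1 < q'.1 ∧ q'.1 < q.2 ∧ q.2 < q'.2) ∨ (q'.1 < q.1 ∧ q.1 < q'.2 ∧ q'.2 < q.2)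

/-- The crossing number `c(S)`: the number of (unordered) pairs of elements of `S`
that cross (each counted once, using the order of first components). -/
def crossNum {n : ℕ} (S : Finset (Fin n × Fin n)) : ℕ :=
  ((S ×ˢ S).filter (fun z => z.1.1 < z.2.1 ∧ crosses z.1 z.2)).card

/-- The scalar part of `D_S(I)`: the product over `{k,l} ∈ S` of `(1/2)(-1)^{k+l} ε_{I_k,I_l}`. -/
def DScalar {n : ℕ} (I : Fin n → Fin 5 × Fin 5) (S : Finset (Fin n × Fin n)) : ℂ :=
  ∏ q ∈ S, ((-1 : ℂ) ^ (q.1.val + q.2.val) *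
    ((eps (I q.1).1 (I q.1).2 (I q.2).1 (I q.2).2 : ℤ) : ℂ) / 2)

/-- The multiplicity of `∂ t` in `D_S(I)`. -/
def pCount {n : ℕ} (I : Fin n → Fin 5 × Fin 5) (S : Finset (Fin n × Fin n)) (t : Fin 5) : ℕ :=
  (S.filter (fun q => tIdx (I q.1).1 (I q.1).2 (I q.2).1 (I q.2).2 = t)).card

section Alg

variable {A : Type*} [Ring A] [Algebra ℂ A]

/-- The monomial `∂^M = ∂_1^{m_1} ⋯ ∂_5^{m_5}`. -/
def pMono (pp : Fin 5 → A) (c : Fin 5 → ℕ) : A :=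
  pp 0 ^ c 0 * pp 1 ^ c 1 * pp 2 ^ c 2 * pp 3 ^ c 3 * pp 4 ^ c 4

/-- `d_{C_S(I)}`: the ordered product of the `d`'s over the positions of `I`
not covered by `S`. -/
def dRest (dd : Fin 5 → Fin 5 → A) {n : ℕ} (I : Fin n → Fin 5 × Fin 5)
    (S : Finset (Fin n × Fin n)) : A :=
  (((Finset.univ.filter (fun i : Fin n => ∀ q ∈ S, i ≠ q.1 ∧ i ≠ q.2)).sort (· ≤ ·)).map
    (fun i => dd (I i).1 (I i).2)).prod

/-- The summand `(-1)^{c(S)} D_S(I) d_{C_S(I)}` of `ω_I` (here `D_S(I)` is written as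
its scalar part times the corresponding `∂`-monomial, to which it is equal since
the `∂`'s commute). -/
def omegaBody (dd : Fin 5 → Fin 5 → A) (pp : Fin 5 → A) {n : ℕ}
    (I : Fin n → Fin 5 × Fin 5) (S : Finset (Fin n × Fin n)) : A :=
  ((-1 : ℂ) ^ crossNum S * DScalar I S) • (pMono pp (pCount I S) * dRest dd I S)

/-- `ω_I = ∑_{S SIF} (-1)^{c(S)} D_S(I) d_{C_S(I)}`. -/
def omegaOf (dd : Fin 5 → Fin 5 → A) (pp : Fin 5 → A) {n : ℕ} (I : Fin n → Fin 5 × Fin 5) : A :=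
  ∑ S : Finset (Fin n × Fin n), if isSIF S then omegaBody dd pp I S else 0

end Alg

/-- Exchanging the two removed positions in a double sum over ordered pairs of positions. -/
theorem Fin.sum_succAbove_predAbove {M : Type*} [AddCommMonoid M] {n : ℕ}
    (F : Fin (n + 1) → Fin n → M) :
    ∑ j, ∑ k, F j k = ∑ j : Fin (n+1), ∑ k : Fin n, F (j.succAbove k) (k.predAbove j) := by
  rw [← Fintype.sum_prod_type', ← Fintype.sum_prod_type']
  refine Finset.sum_nbij' (fun p => (p.1.succAbove p.2, p.2.predAbove p.1))
    (fun p => (p.1.succAbove p.2, p.2.predAbove p.1)) ?_ ?_ ?_ ?_ ?_ <;>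
    simp [Fin.predAbove_predAbove_succAbove, Fin.succAbove_succAbove_predAbove]

/-- If `W` satisfies the Wick expansion along the first entry, then it satisfies the averaged
expansion along all entries. -/
theorem wick_recursion {A ι : Type*} [Ring A] [Algebra ℂ A] (x : ι → A) (c : ι → ι → A)
    (hc : ∀ i j, x i * x j + x j * x i = c i j)
    (hcx : ∀ i j k, Commute (c i j) (x k))
    (W : ∀ n, (Fin n → ι) → A)
    (hW1 : ∀ I, W 1 I = x (I 0) * W 0 (fun a => I a.succ))
    (hW : ∀ n (I : Fin (n + 2) → ι), W (n + 2) I = x (I 0) * W (n + 1) (fun a => I a.succ) +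
      ∑ k : Fin (n + 1), ((-1 : ℂ) ^ (k.val + 1) / 2) •
        (c (I 0) (I k.succ) * W n (fun a => I (k.succAbove a).succ)))
    (n : ℕ) (I : Fin (n + 1) → ι) :
    ((n : ℂ) + 1) • W (n + 1) I =
      ∑ j : Fin (n + 1), (-1 : ℂ) ^ j.val • (x (I j) * W n (fun a => I (j.succAbove a))) := by
  have hx : ∀ i j, x j * x i = c i j - x i * x j := fun i j => by rw [← hc]; abel
  induction n using Nat.twoStepInduction with
  | zero => simp [hW1]
  | one =>
    have e0 : ∀ f : Fin 0 → ι, W 0 f = W 0 Fin.elim0 := fun f =>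
      congrArg (W 0) (Subsingleton.elim _ _)
    have e1 : ∀ f : Fin 1 → ι, W 1 f = x (f 0) * W 0 Fin.elim0 := fun f => by rw [hW1, e0]
    rw [hW]
    simp only [e0, e1]
    simp [← hc, ← mul_assoc, add_mul]
    module
  | more n ih0 ih1 =>
    set J : Fin (n + 2) → ι := fun a => I a.succ with hJ
    set a := x (I 0) with ha
    set V : Fin (n + 2) → A := fun j => W (n + 1) (fun b => J (j.succAbove b)) with hV
    have h1 : ((n : ℂ) + 2) • W (n + 2) J = ∑ j : Fin (n + 2), (-1 : ℂ) ^ j.val • (x (J j) * V j) := by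
      rw [← ih1 J]; push_cast; congr 1; ring
    have h0 : ∀ k : Fin (n + 2), ((n : ℂ) + 1) • V k = _ :=
      fun k => ih0 (fun b => J (k.succAbove b))
    have hfront : ∀ j : Fin (n + 2), W (n + 2) (fun b => I (j.succ.succAbove b)) =
        a * V j + ∑ k : Fin (n + 1), ((-1 : ℂ) ^ (k.val + 1) / 2) •
          (c (I 0) (J (j.succAbove k)) * W n (fun b => J (j.succAbove (k.succAbove b)))) := by
      intro j
      rw [hW]
      simp only [Fin.succ_succAbove_zero, Fin.succ_succAbove_succ]
      rfl
    have hA : ∑ j : Fin (n + 2), (-1 : ℂ) ^ (j.val + 1) • (x (J j) * (a * V j)) =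
        ((n : ℂ) + 2) • (a * W (n + 2) J) +
          ∑ j : Fin (n + 2), (-1 : ℂ) ^ (j.val + 1) • (c (I 0) (J j) * V j) := by
      rw [← mul_smul_comm, h1, Finset.mul_sum, ← Finset.sum_add_distrib]
      refine Finset.sum_congr rfl fun j _ => ?_
      rw [← mul_assoc, hx (I 0), sub_mul, mul_smul_comm, mul_assoc]
      rw [pow_succ]
      module
    have hB : ∑ j : Fin (n + 2), (-1 : ℂ) ^ (j.val + 1) • (x (J j) *
          ∑ k : Fin (n + 1), ((-1 : ℂ) ^ (k.val + 1) / 2) •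
          (c (I 0) (J (j.succAbove k)) * W n (fun b => J (j.succAbove (k.succAbove b))))) =
        (((n : ℂ) + 1) / 2) •
          ∑ j : Fin (n + 2), (-1 : ℂ) ^ (j.val + 1) • (c (I 0) (J j) * V j) := by
      have : ∀ (j : Fin (n + 2)) (k : Fin (n + 1)), (-1 : ℂ) ^ (j.val + 1) • (x (J j) *
          (((-1 : ℂ) ^ (k.val + 1) / 2) •
          (c (I 0) (J (j.succAbove k)) * W n (fun b => J (j.succAbove (k.succAbove b)))))) =
          ((-1 : ℂ) ^ (j.val + k.val) / 2) • (c (I 0) (J (j.succAbove k)) *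
            (x (J j) * W n (fun b => J (j.succAbove (k.succAbove b))))) := by
        intro j k
        rw [← mul_assoc (c _ _), (hcx _ _ _).eq, mul_smul_comm, smul_smul, mul_assoc]
        congr 1
        ring
      simp only [Finset.mul_sum, Finset.smul_sum, this]
      rw [Fin.sum_succAbove_predAbove]
      refine Finset.sum_congr rfl fun j _ => ?_
      simp only [Fin.succAbove_succAbove_predAbove, Fin.succAbove_succAbove_succAbove_predAbove,
        Fin.neg_one_pow_succAbove_add_predAbove]
      have e : (((n : ℂ) + 1) / 2) • (-1 : ℂ) ^ (j.val + 1) • (c (I 0) (J j) * V j) =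
          ((-1 : ℂ) ^ (j.val + 1) / 2) • (c (I 0) (J j) * (((n : ℂ) + 1) • V j)) := by
        rw [mul_smul_comm]; module
      rw [e, h0, Finset.mul_sum, Finset.smul_sum]
      refine Finset.sum_congr rfl fun k _ => ?_
      rw [mul_smul_comm, smul_smul]
      congr 1
      ring
    have hI : W (n + 3) I = a * W (n + 2) J + (1 / 2 : ℂ) •
        ∑ j : Fin (n + 2), (-1 : ℂ) ^ (j.val + 1) • (c (I 0) (J j) * V j) := by
      rw [hW, Finset.smul_sum]
      congr 1
      refine Finset.sum_congr rfl fun k _ => ?_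
      rw [smul_smul]
      congr 1
      ring
    have hR : ∑ j : Fin (n + 2), (-1 : ℂ) ^ (j.val + 1) •
        (x (J j) * W (n + 2) (fun b => I (j.succ.succAbove b))) =
        (((n : ℂ) + 2) • (a * W (n + 2) J) +
          ∑ j : Fin (n + 2), (-1 : ℂ) ^ (j.val + 1) • (c (I 0) (J j) * V j)) +
        (((n : ℂ) + 1) / 2) •
          ∑ j : Fin (n + 2), (-1 : ℂ) ^ (j.val + 1) • (c (I 0) (J j) * V j) := by
      simp only [hfront, mul_add, smul_add, Finset.sum_add_distrib]
      rw [hA, hB]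
    rw [Fin.sum_univ_succ]
    simp only [Fin.val_succ]
    rw [show W (n + 2 + 1) I = _ from hI]
    refine Eq.trans ?_ (congrArg _ hR.symm)
    simp only [Fin.succAbove_zero, Fin.val_zero, pow_zero]
    push_cast
    module

/-- The image of a family of position pairs under an order embedding of the positions. -/
def mapPairs {m n : ℕ} (g : Fin m ↪o Fin n) (S : Finset (Fin m × Fin m)) :
    Finset (Fin n × Fin n) :=
  S.map (g.toEmbedding.prodMap g.toEmbedding)

theorem mem_mapPairs {m n : ℕ} {g : Fin m ↪o Fin n} {S : Finset (Fin m × Fin m)}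
    {q : Fin n × Fin n} : q ∈ mapPairs g S ↔ ∃ r ∈ S, (g r.1, g r.2) = q := by
  simp only [mapPairs, Finset.mem_map]
  rfl

theorem forall_mem_mapPairs {m n : ℕ} {g : Fin m ↪o Fin n} {S : Finset (Fin m × Fin m)}
    {P : Fin n × Fin n → Prop} : (∀ q ∈ mapPairs g S, P q) ↔ ∀ r ∈ S, P (g r.1, g r.2) :=
  Finset.forall_mem_map

theorem mapPairs_injective {m n : ℕ} (g : Fin m ↪o Fin n) :
    Function.Injective (mapPairs g) := Finset.map_injective _

theorem exists_mapPairs_eq {m n : ℕ} (g : Fin m ↪o Fin n) {S : Finset (Fin n × Fin n)}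
    (h : ∀ q ∈ S, q.1 ∈ Set.range g ∧ q.2 ∈ Set.range g) : ∃ T, mapPairs g T = S := by
  refine ⟨Finset.univ.filter fun r => (g r.1, g r.2) ∈ S, ?_⟩
  ext q
  rw [mem_mapPairs]
  constructor
  · rintro ⟨r, hr, rfl⟩
    simpa using hr
  · intro hq
    obtain ⟨⟨a, ha⟩, b, hb⟩ := h q hq
    exact ⟨(a, b), by simpa [ha, hb] using hq, by simp [ha, hb]⟩

theorem isSIF_mapPairs {m n : ℕ} (g : Fin m ↪o Fin n) (S : Finset (Fin m × Fin m)) :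
    isSIF (mapPairs g S) ↔ isSIF S := by
  simp only [isSIF, mapPairs, Finset.forall_mem_map, Function.Embedding.coe_prodMap, Prod.map,
    RelEmbedding.coe_toEmbedding, OrderEmbedding.lt_iff_lt, ne_eq, EmbeddingLike.apply_eq_iff_eq,
    Prod.ext_iff]

theorem crossNum_mapPairs {m n : ℕ} (g : Fin m ↪o Fin n) (S : Finset (Fin m × Fin m)) :
    crossNum (mapPairs g S) = crossNum S := by
  rw [crossNum, crossNum, mapPairs, ← Finset.prodMap_map_product, Finset.filter_map, Finset.card_map]
  congr 1
  refine Finset.filter_congr fun z _ => ?_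
  simp [crosses]

theorem crossNum_insert {n : ℕ} (S : Finset (Fin n × Fin n)) (q : Fin n × Fin n)
    (hq : ∀ r ∈ S, q.1 < r.1) :
    crossNum (insert q S) = crossNum S + (S.filter fun r => crosses q r).card := by
  have hqS : q ∉ S := fun h => lt_irrefl _ (hq q h)
  have e : ((insert q S ×ˢ insert q S).filter fun z => z.1.1 < z.2.1 ∧ crosses z.1 z.2) =
      ((S ×ˢ S).filter fun z => z.1.1 < z.2.1 ∧ crosses z.1 z.2).disjUnion
        ((S.filter fun r => crosses q r).map ⟨fun r => (q, r), Prod.mk_right_injective q⟩)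
        (by
          rw [Finset.disjoint_left]
          rintro ⟨a, b⟩ h h'
          simp only [Finset.mem_map, Finset.mem_filter, Finset.mem_product,
            Function.Embedding.coeFn_mk, Prod.mk.injEq] at h h'
          obtain ⟨r, _, rfl, rfl⟩ := h'
          exact hqS h.1.1) := by
    ext ⟨a, b⟩
    simp only [Finset.mem_map, Finset.mem_filter, Finset.mem_product, Finset.mem_disjUnion,
      Function.Embedding.coeFn_mk, Prod.mk.injEq, Finset.mem_insert]
    constructor
    · rintro ⟨⟨rfl | ha, rfl | hb⟩, hlt, hcr⟩
      · exact absurd hlt (lt_irrefl _)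
      · exact Or.inr ⟨b, ⟨hb, hcr⟩, rfl, rfl⟩
      · exact absurd hlt (hq a ha).asymm
      · exact Or.inl ⟨⟨ha, hb⟩, hlt, hcr⟩
    · rintro (⟨⟨ha, hb⟩, h⟩ | ⟨r, ⟨hr, hcr⟩, rfl, rfl⟩)
      · exact ⟨⟨Or.inr ha, Or.inr hb⟩, h⟩
      · exact ⟨⟨Or.inl rfl, Or.inr hr⟩, hq r hr, hcr⟩
  rw [crossNum, e, Finset.card_disjUnion, Finset.card_map, crossNum]

theorem pCount_mapPairs {m n : ℕ} (g : Fin m ↪o Fin n) (I : Fin n → Fin 5 × Fin 5)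
    (S : Finset (Fin m × Fin m)) :
    pCount I (mapPairs g S) = pCount (fun a => I (g a)) S := by
  funext t
  rw [pCount, pCount, mapPairs, Finset.filter_map, Finset.card_map]
  rfl

theorem pCount_insert {n : ℕ} (I : Fin n → Fin 5 × Fin 5) (S : Finset (Fin n × Fin n))
    (q : Fin n × Fin n) (hq : q ∉ S) :
    pCount I (insert q S) = fun t => pCount I S t +
      if tIdx (I q.1).1 (I q.1).2 (I q.2).1 (I q.2).2 = t then 1 else 0 := by
  funext t
  rw [pCount, pCount, Finset.filter_insert]
  split_ifs with h
  · rw [Finset.card_insert_of_notMem (by simp [hq])]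
  · simp

theorem pMono_add_single {A : Type*} [Ring A] (pp : Fin 5 → A)
    (hpp : ∀ s t, pp s * pp t = pp t * pp s) (c : Fin 5 → ℕ) (s : Fin 5) :
    pMono pp (fun t => c t + if s = t then 1 else 0) = pp s * pMono pp c := by
  have h : ∀ s t k, pp s ^ k * pp t = pp t * pp s ^ k := fun s t k =>
    (show Commute (pp s) (pp t) from hpp s t).pow_left k
  have h' : ∀ s t k (y : A), pp s ^ k * (pp t * y) = pp t * (pp s ^ k * y) := fun s t k y => by
    rw [← mul_assoc, h, mul_assoc]
  fin_cases s <;> simp [pMono, pow_succ', mul_assoc, h']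

theorem DScalar_mapPairs_succ {n : ℕ} (I : Fin (n + 1) → Fin 5 × Fin 5)
    (S : Finset (Fin n × Fin n)) :
    DScalar I (mapPairs (Fin.succOrderEmb n) S) = DScalar (fun a => I a.succ) S := by
  rw [DScalar, DScalar, mapPairs, Finset.prod_map]
  refine Finset.prod_congr rfl fun q _ => ?_
  simp only [Function.Embedding.coe_prodMap, Prod.map, RelEmbedding.coe_toEmbedding,
    Fin.coe_succOrderEmb, Fin.val_succ]
  congr 2
  ring

/-- The order embedding whose range omits the positions `0` and `k.succ`. -/
def skipPair {n : ℕ} (k : Fin (n + 1)) : Fin n ↪o Fin (n + 2) :=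
  (Fin.succAboveOrderEmb k).trans (Fin.succOrderEmb (n + 1))

theorem skipPair_apply {n : ℕ} (k : Fin (n + 1)) (a : Fin n) :
    skipPair k a = (k.succAbove a).succ := rfl

theorem mem_range_skipPair {n : ℕ} (k : Fin (n + 1)) (i : Fin (n + 2)) :
    i ∈ Set.range (skipPair k) ↔ i ≠ 0 ∧ i ≠ k.succ := by
  refine Fin.cases ?_ (fun j => ?_) i
  · simp [skipPair_apply, Fin.succ_ne_zero]
  · simp only [Set.mem_range, skipPair_apply, Fin.succ_inj, ne_eq, Fin.succ_ne_zero,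
      not_false_eq_true, true_and]
    exact Fin.exists_succAbove_eq_iff

/-- The family of pairs obtained by adjoining the pair `(0, k.succ)`. -/
def insertPair {n : ℕ} (k : Fin (n + 1)) (S : Finset (Fin n × Fin n)) :
    Finset (Fin (n + 2) × Fin (n + 2)) :=
  insert (0, k.succ) (mapPairs (skipPair k) S)

theorem zero_lt_of_mem_mapPairs_skipPair {n : ℕ} {k : Fin (n + 1)} {S : Finset (Fin n × Fin n)}
    {q : Fin (n + 2) × Fin (n + 2)} (hq : q ∈ mapPairs (skipPair k) S) : 0 < q.1 := by
  obtain ⟨r, _, rfl⟩ := mem_mapPairs.1 hq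
  exact Fin.succ_pos _

theorem pair_notMem_mapPairs {n : ℕ} (k l : Fin (n + 1)) (S : Finset (Fin n × Fin n)) :
    (0, l.succ) ∉ mapPairs (skipPair k) S :=
  fun h => lt_irrefl _ (zero_lt_of_mem_mapPairs_skipPair h)

theorem neg_one_pow_val_succAbove {n : ℕ} (k : Fin (n + 1)) (a : Fin n) :
    (-1 : ℂ) ^ (k.succAbove a).val =
      (if k < k.succAbove a then -1 else 1) * (-1 : ℂ) ^ a.val := by
  rcases Fin.lt_or_le a.castSucc k with h | h
  · rw [Fin.succAbove_of_castSucc_lt _ _ h, if_neg h.asymm]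
    simp
  · rw [Fin.succAbove_of_le_castSucc _ _ h, if_pos (Fin.le_castSucc_iff.1 h)]
    simp [pow_succ]

theorem sign_mul_DScalar_insertPair {n : ℕ} (I : Fin (n + 2) → Fin 5 × Fin 5) (k : Fin (n + 1))
    (S : Finset (Fin n × Fin n)) (hS : isSIF S) :
    (-1 : ℂ) ^ crossNum (insertPair k S) * DScalar I (insertPair k S) =
      ((-1 : ℂ) ^ (k.val + 1) / 2 *
        ((eps (I 0).1 (I 0).2 (I k.succ).1 (I k.succ).2 : ℤ) : ℂ)) *
      ((-1 : ℂ) ^ crossNum S * DScalar (fun a => I (k.succAbove a).succ) S) := by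
  have hc : (-1 : ℂ) ^ ((mapPairs (skipPair k) S).filter fun r => crosses (0, k.succ) r).card *
      DScalar I (mapPairs (skipPair k) S) = DScalar (fun a => I (k.succAbove a).succ) S := by
    rw [← Finset.prod_const, Finset.prod_filter, DScalar, DScalar, ← Finset.prod_mul_distrib,
      mapPairs, Finset.prod_map]
    refine Finset.prod_congr rfl fun q hq => ?_
    have hlt : k.succAbove q.1 < k.succAbove q.2 := by simpa using hS.1 q hq
    have hne := Fin.succAbove_ne k q.1
    have hcr : crosses (0, k.succ) (skipPair k q.1, skipPair k q.2) ↔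
        k.succAbove q.1 < k ∧ k < k.succAbove q.2 := by
      simp [crosses, skipPair_apply]
    simp only [Function.Embedding.coe_prodMap, Prod.map, RelEmbedding.coe_toEmbedding, hcr]
    simp only [skipPair_apply, Fin.val_succ, pow_add, neg_one_pow_val_succAbove]
    rcases lt_or_gt_of_ne hne with h | h
    · by_cases h2 : k < k.succAbove q.2
      · simp [h, h2, h.asymm, neg_div]
      · simp [h2, h.asymm]
    · simp [h, h.asymm, h.trans hlt]
  rw [insertPair, crossNum_insert _ _ fun r hr => zero_lt_of_mem_mapPairs_skipPair hr,
    crossNum_mapPairs, ← hc, DScalar, Finset.prod_insert (pair_notMem_mapPairs k k S), ← DScalar]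
  simp only [Fin.val_zero, Fin.val_succ, zero_add]
  ring

theorem dRest_mapPairs_succ {A : Type*} [Ring A] (dd : Fin 5 → Fin 5 → A) {n : ℕ}
    (I : Fin (n + 1) → Fin 5 × Fin 5) (S : Finset (Fin n × Fin n)) :
    dRest dd I (mapPairs (Fin.succOrderEmb n) S) =
      dd (I 0).1 (I 0).2 * dRest dd (fun a => I a.succ) S := by
  have e : (Finset.univ.filter fun i : Fin (n + 1) =>
      ∀ q ∈ mapPairs (Fin.succOrderEmb n) S, i ≠ q.1 ∧ i ≠ q.2) =
      insert 0 ((Finset.univ.filter fun i : Fin n => ∀ q ∈ S, i ≠ q.1 ∧ i ≠ q.2).map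
        (Fin.succOrderEmb n).toEmbedding) := by
    ext i
    simp only [forall_mem_mapPairs]
    refine Fin.cases ?_ (fun j => ?_) i
    · simp [(Fin.succ_ne_zero _).symm]
    · simp [Fin.succ_ne_zero]
  rw [dRest, e, Finset.sort_insert _ (by simp) (by simp [Fin.succ_ne_zero]), List.map_cons,
    List.prod_cons, ← Finset.map_sort _ _ (· ≤ ·) _ (by simp), List.map_map]
  rfl

theorem dRest_insertPair {A : Type*} [Ring A] (dd : Fin 5 → Fin 5 → A) {n : ℕ}
    (I : Fin (n + 2) → Fin 5 × Fin 5) (k : Fin (n + 1)) (S : Finset (Fin n × Fin n)) :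
    dRest dd I (insertPair k S) = dRest dd (fun a => I (k.succAbove a).succ) S := by
  have e : (Finset.univ.filter fun i : Fin (n + 2) =>
      ∀ q ∈ insertPair k S, i ≠ q.1 ∧ i ≠ q.2) =
      (Finset.univ.filter fun i : Fin n => ∀ q ∈ S, i ≠ q.1 ∧ i ≠ q.2).map
        (skipPair k).toEmbedding := by
    ext i
    simp only [insertPair, Finset.forall_mem_insert, forall_mem_mapPairs]
    by_cases hi : i ∈ Set.range (skipPair k)
    · obtain ⟨j, rfl⟩ := hi
      have := (mem_range_skipPair k (skipPair k j)).1 ⟨j, rfl⟩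
      simp [this]
    · have h1 : i = 0 ∨ i = k.succ := by
        rw [mem_range_skipPair] at hi
        tauto
      constructor
      · intro h
        have := (Finset.mem_filter.1 h).2.1
        exact absurd h1 (by tauto)
      · intro h
        obtain ⟨j, _, rfl⟩ := Finset.mem_map.1 h
        exact absurd ⟨j, rfl⟩ hi
  rw [dRest, e, ← Finset.map_sort _ _ (· ≤ ·) _ (by simp), List.map_map]
  rfl

section Recursion

variable {A : Type*} [Ring A] [Algebra ℂ A]

theorem omegaBody_mapPairs_succ (R : E510Rep A) {n : ℕ} (I : Fin (n + 1) → Fin 5 × Fin 5)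
    (S : Finset (Fin n × Fin n)) :
    omegaBody R.d R.p I (mapPairs (Fin.succOrderEmb n) S) =
      R.d (I 0).1 (I 0).2 * omegaBody R.d R.p (fun a => I a.succ) S := by
  have hcomm : Commute (pMono R.p (pCount (fun a => I a.succ) S)) (R.d (I 0).1 (I 0).2) := by
    have h : ∀ t, Commute (R.p t) (R.d (I 0).1 (I 0).2) := fun t => R.pd_comm _ _ _
    unfold pMono
    exact (((((h 0).pow_left _).mul_left ((h 1).pow_left _)).mul_left
      ((h 2).pow_left _)).mul_left ((h 3).pow_left _)).mul_left ((h 4).pow_left _)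
  simp only [omegaBody, crossNum_mapPairs, DScalar_mapPairs_succ, dRest_mapPairs_succ,
    pCount_mapPairs]
  rw [mul_smul_comm, ← mul_assoc (R.d _ _), ← hcomm.eq, mul_assoc]
  rfl

theorem omegaBody_insertPair (R : E510Rep A) {n : ℕ} (I : Fin (n + 2) → Fin 5 × Fin 5)
    (k : Fin (n + 1)) (S : Finset (Fin n × Fin n)) (hS : isSIF S) :
    omegaBody R.d R.p I (insertPair k S) =
      ((-1 : ℂ) ^ (k.val + 1) / 2) •
        ((R.d (I 0).1 (I 0).2 * R.d (I k.succ).1 (I k.succ).2 +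
          R.d (I k.succ).1 (I k.succ).2 * R.d (I 0).1 (I 0).2) *
        omegaBody R.d R.p (fun a => I (k.succAbove a).succ) S) := by
  rw [omegaBody, sign_mul_DScalar_insertPair I k S hS, dRest_insertPair, insertPair,
    pCount_insert I _ _ (pair_notMem_mapPairs k k S), pMono_add_single R.p R.pp_comm,
    pCount_mapPairs, R.dd_rel, ← Int.cast_smul_eq_zsmul ℂ, omegaBody, smul_mul_assoc,
    mul_smul_comm, smul_smul, smul_smul, mul_assoc (R.p _)]
  rfl

theorem eq_of_mem_isSIF {n : ℕ} {S : Finset (Fin n × Fin n)} (hS : isSIF S)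
    {q r : Fin n × Fin n} (hq : q ∈ S) (hr : r ∈ S) (h : q.1 = r.1) : q = r := by
  by_contra hne
  exact (hS.2 q hq r hr hne).1 h

theorem isSIF_insertPair {n : ℕ} (k : Fin (n + 1)) {S : Finset (Fin n × Fin n)} (hS : isSIF S) :
    isSIF (insertPair k S) := by
  have hT := (isSIF_mapPairs (skipPair k) S).2 hS
  have hne : ∀ r ∈ mapPairs (skipPair k) S,
      (r.1 ≠ 0 ∧ r.1 ≠ k.succ) ∧ (r.2 ≠ 0 ∧ r.2 ≠ k.succ) := by
    rw [forall_mem_mapPairs]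
    exact fun r _ => ⟨(mem_range_skipPair k _).1 ⟨_, rfl⟩, (mem_range_skipPair k _).1 ⟨_, rfl⟩⟩
  refine ⟨fun q hq => ?_, fun q hq r hr hqr => ?_⟩
  · rcases Finset.mem_insert.1 hq with rfl | hq
    · exact Fin.succ_pos k
    · exact hT.1 q hq
  · rcases Finset.mem_insert.1 hq with rfl | hq <;> rcases Finset.mem_insert.1 hr with rfl | hr
    · exact absurd rfl hqr
    · have := hne r hr
      exact ⟨this.1.1.symm, this.2.1.symm, this.1.2.symm, this.2.2.symm⟩
    · have := hne q hq
      exact ⟨this.1.1, this.1.2, this.2.1, this.2.2⟩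
    · exact hT.2 q hq r hr hqr

theorem insertPair_injective {n : ℕ} {k l : Fin (n + 1)} {S T : Finset (Fin n × Fin n)}
    (h : insertPair k S = insertPair l T) : k = l ∧ S = T := by
  have hkl : k = l := by
    have hk : ((0 : Fin (n + 2)), k.succ) ∈ insertPair l T :=
      h ▸ Finset.mem_insert_self _ _
    rcases Finset.mem_insert.1 hk with hk | hk
    · exact Fin.succ_injective _ (Prod.ext_iff.1 hk).2
    · exact absurd hk (pair_notMem_mapPairs l k T)
  subst hkl
  refine ⟨rfl, mapPairs_injective (skipPair k) ?_⟩
  rw [← Finset.erase_insert (pair_notMem_mapPairs k k S),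
    ← Finset.erase_insert (pair_notMem_mapPairs k k T)]
  exact congrArg (fun U => Finset.erase U (0, k.succ)) h

theorem exists_insertPair_eq {n : ℕ} {S : Finset (Fin (n + 2) × Fin (n + 2))} (hS : isSIF S)
    {q : Fin (n + 2) × Fin (n + 2)} (hq : q ∈ S) (hq0 : q.1 = 0) :
    ∃ k T, isSIF T ∧ insertPair k T = S := by
  obtain ⟨a, b⟩ := q
  obtain rfl : a = 0 := hq0
  obtain ⟨k, rfl⟩ := Fin.exists_succ_eq.2 (hS.1 _ hq).ne'
  obtain ⟨T, hT⟩ := exists_mapPairs_eq (skipPair k) (S := S.erase (0, k.succ)) fun r hr => by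
    have hr' := Finset.mem_erase.1 hr
    have := hS.2 r hr'.2 _ hq hr'.1
    exact ⟨(mem_range_skipPair k _).2 ⟨this.1, this.2.1⟩,
      (mem_range_skipPair k _).2 ⟨this.2.2.1, this.2.2.2⟩⟩
  refine ⟨k, T, ?_, ?_⟩
  · rw [← isSIF_mapPairs (skipPair k), hT]
    exact ⟨fun r hr => hS.1 r (Finset.mem_of_mem_erase hr), fun r hr s hs =>
      hS.2 r (Finset.mem_of_mem_erase hr) s (Finset.mem_of_mem_erase hs)⟩
  · rw [insertPair, hT, Finset.insert_erase hq]

theorem omegaOf_eq_sum_filter (dd : Fin 5 → Fin 5 → A) (pp : Fin 5 → A) {n : ℕ}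
    (I : Fin n → Fin 5 × Fin 5) :
    omegaOf dd pp I = ∑ S ∈ Finset.univ.filter isSIF, omegaBody dd pp I S :=
  (Finset.sum_filter _ _).symm

theorem sum_isSIF_filter_ne_zero (R : E510Rep A) {n : ℕ} (I : Fin (n + 1) → Fin 5 × Fin 5) :
    ∑ S ∈ (Finset.univ.filter isSIF).filter
        (fun S : Finset (Fin (n + 1) × Fin (n + 1)) => ∀ q ∈ S, q.1 ≠ 0),
      omegaBody R.d R.p I S =
    R.d (I 0).1 (I 0).2 * omegaOf R.d R.p (fun a => I a.succ) := by
  rw [omegaOf_eq_sum_filter, Finset.mul_sum]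
  symm
  refine Finset.sum_nbij (mapPairs (Fin.succOrderEmb n)) (fun S hS => ?_)
    (mapPairs_injective _).injOn (fun S hS => ?_)
    (fun S _ => (omegaBody_mapPairs_succ R I S).symm)
  · simp only [Finset.mem_filter, Finset.mem_univ, true_and] at hS ⊢
    refine ⟨(isSIF_mapPairs _ _).2 hS, ?_⟩
    rw [forall_mem_mapPairs]
    exact fun r _ => Fin.succ_ne_zero _
  · simp only [Finset.coe_filter, Finset.mem_filter, Finset.mem_univ, true_and,
      Set.mem_ofPred_eq] at hS
    obtain ⟨T, rfl⟩ := exists_mapPairs_eq (Fin.succOrderEmb n) (S := S) fun q hq =>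
      ⟨Fin.exists_succ_eq.2 (hS.2 q hq),
        Fin.exists_succ_eq.2 ((Fin.zero_le _).trans_lt (hS.1.1 q hq)).ne'⟩
    exact ⟨T, by simpa using (isSIF_mapPairs _ _).1 hS.1, rfl⟩

theorem sum_isSIF_filter_exists_zero (R : E510Rep A) {n : ℕ} (I : Fin (n + 2) → Fin 5 × Fin 5) :
    ∑ S ∈ (Finset.univ.filter isSIF).filter
        (fun S : Finset (Fin (n + 2) × Fin (n + 2)) => ¬ ∀ q ∈ S, q.1 ≠ 0),
      omegaBody R.d R.p I S =
    ∑ k : Fin (n + 1), ((-1 : ℂ) ^ (k.val + 1) / 2) •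
      ((R.d (I 0).1 (I 0).2 * R.d (I k.succ).1 (I k.succ).2 +
          R.d (I k.succ).1 (I k.succ).2 * R.d (I 0).1 (I 0).2) *
        omegaOf R.d R.p (fun a => I (k.succAbove a).succ)) := by
  simp only [omegaOf_eq_sum_filter, Finset.mul_sum, Finset.smul_sum]
  rw [← Finset.sum_product']
  symm
  refine Finset.sum_nbij (fun z => insertPair z.1 z.2) (fun z hz => ?_)
    (fun z _ w _ h => Prod.ext_iff.2 (insertPair_injective h)) (fun S hS => ?_)
    (fun z hz => (omegaBody_insertPair R I z.1 z.2 (by simpa using hz)).symm)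
  · simp only [Finset.mem_product, Finset.mem_filter, Finset.mem_univ, true_and] at hz ⊢
    exact ⟨isSIF_insertPair _ hz, fun h => h _ (Finset.mem_insert_self _ _) rfl⟩
  · simp only [Finset.coe_filter, Finset.mem_filter, Finset.mem_univ, true_and,
      Set.mem_ofPred_eq, not_forall, not_not] at hS
    obtain ⟨hS, q, hq, hq0⟩ := hS
    obtain ⟨k, T, hT, rfl⟩ := exists_insertPair_eq hS hq hq0
    exact ⟨(k, T), by simpa using hT, rfl⟩

theorem omegaOf_one (R : E510Rep A) (I : Fin 1 → Fin 5 × Fin 5) :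
    omegaOf R.d R.p I = R.d (I 0).1 (I 0).2 * omegaOf R.d R.p (fun a => I a.succ) := by
  rw [← sum_isSIF_filter_ne_zero, omegaOf_eq_sum_filter,
    Finset.filter_true_of_mem (s := Finset.univ.filter isSIF)]
  intro S hS q hq
  have := (Finset.mem_filter.1 hS).2.1 q hq
  omega

/-- Splitting off the first position: either it is unmatched, or it is matched with `k.succ`. -/
theorem omegaOf_add_two (R : E510Rep A) {n : ℕ} (I : Fin (n + 2) → Fin 5 × Fin 5) :
    omegaOf R.d R.p I = R.d (I 0).1 (I 0).2 * omegaOf R.d R.p (fun a => I a.succ) +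
      ∑ k : Fin (n + 1), ((-1 : ℂ) ^ (k.val + 1) / 2) •
        ((R.d (I 0).1 (I 0).2 * R.d (I k.succ).1 (I k.succ).2 +
            R.d (I k.succ).1 (I k.succ).2 * R.d (I 0).1 (I 0).2) *
          omegaOf R.d R.p (fun a => I (k.succAbove a).succ)) := by
  rw [← sum_isSIF_filter_ne_zero, ← sum_isSIF_filter_exists_zero,
    Finset.sum_filter_add_sum_filter_not, ← omegaOf_eq_sum_filter]

end Recursion

/-- Proposition (recursion): `ω_I = (1/d) ∑_{j=1}^d (-1)^{j-1} d_{I_j} ω_{(I_1,…,Î_j,…,I_d)}`. -/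
theorem omega_recursion {A : Type*} [Ring A] [Algebra ℂ A] (R : E510Rep A)
    (d : ℕ) (I : Fin (d + 1) → Fin 5 × Fin 5) :
    omegaOf R.d R.p I
      = ((1 : ℂ) / ((d : ℂ) + 1)) •
          ∑ j : Fin (d + 1), ((-1 : ℂ) ^ (j : ℕ)) •
            (R.d (I j).1 (I j).2 *
              omegaOf R.d R.p (fun a : Fin d => I (j.succAbove a))) := by
  have hd : ((d : ℂ) + 1) ≠ 0 := Nat.cast_add_one_ne_zero d
  have h := wick_recursion (fun i : Fin 5 × Fin 5 => R.d i.1 i.2)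
    (fun i j => R.d i.1 i.2 * R.d j.1 j.2 + R.d j.1 j.2 * R.d i.1 i.2)
    (fun _ _ => rfl)
    (fun i j k => by
      rw [R.dd_rel]
      exact Commute.smul_left (R.pd_comm _ _ _) _)
    (fun n I => omegaOf R.d R.p I) (omegaOf_one R) (fun n I => omegaOf_add_two R I) d I
  rw [← h, smul_smul, one_div, inv_mul_cancel₀ hd, one_smul]

end
end

section
/- Let $d\ge 3$, let $3\le k\le d$, let $I\in\mathcal{I}_d$, and let $J\in\mathcal{I}_d$ be the tuple obtained from $I$ by exchanging the entries $I_{k-1}$ and $I_k$. For a SIF set $S$ with $\{1,k\}\in S$, let $S'$ be the set obtained from $S$ by exchanging $k$ and $k-1$ inside its elements. Then $S\mapsto S'$ is a bijection from the SIF subsets of 2-element subsets of $\{1,\dots,d\}$ containing $\{1,k\}$ onto those containing $\{1,k-1\}$, and for every such $S$ one has $d_{C_S(I)}=d_{C_{S'}(J)}$ and $(-1)^{c(S)}D_S(I)=-(-1)^{c(S')}D_{S'}(J)$ in $A$. -/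
open scoped Classical

noncomputable section
/-- The pair `{q.1, q.2}` moved by the permutation `τ`, with its smaller entry first. -/
def permPair {n : ℕ} (τ : Equiv.Perm (Fin n)) (q : Fin n × Fin n) : Fin n × Fin n :=
  if τ q.1 < τ q.2 then (τ q.1, τ q.2) else (τ q.2, τ q.1)

theorem permPair_eq_or {n : ℕ} (τ : Equiv.Perm (Fin n)) (q : Fin n × Fin n) :
    permPair τ q = (τ q.1, τ q.2) ∨ permPair τ q = (τ q.2, τ q.1) := by
  unfold permPair
  split_ifs
  · exact Or.inl rfl
  · exact Or.inr rfl

theorem permPair_fst_lt_snd {n : ℕ} (τ : Equiv.Perm (Fin n)) {q : Fin n × Fin n}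
    (h : q.1 < q.2) : (permPair τ q).1 < (permPair τ q).2 := by
  unfold permPair
  split_ifs with h'
  · exact h'
  · exact lt_of_le_of_ne (not_lt.1 h') fun e => h.ne (τ.injective e.symm)

theorem permPair_permPair {n : ℕ} {τ : Equiv.Perm (Fin n)} (hτ : Function.Involutive τ)
    {q : Fin n × Fin n} (h : q.1 < q.2) : permPair τ (permPair τ q) = q := by
  rcases permPair_eq_or τ q with e | e <;> rw [e] <;>
    simp [permPair, hτ q.1, hτ q.2, h, h.not_gt]

theorem isSIF.image_permPair {n : ℕ} {S : Finset (Fin n × Fin n)} (hS : isSIF S)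
    (τ : Equiv.Perm (Fin n)) : isSIF (S.image (permPair τ)) := by
  refine ⟨?_, ?_⟩
  · intro q hq
    obtain ⟨p, hp, rfl⟩ := Finset.mem_image.1 hq
    exact permPair_fst_lt_snd τ (hS.1 p hp)
  · intro q hq q' hq' hne
    obtain ⟨p, hp, rfl⟩ := Finset.mem_image.1 hq
    obtain ⟨p', hp', rfl⟩ := Finset.mem_image.1 hq'
    have hpp : p ≠ p' := fun e => hne (e ▸ rfl)
    obtain ⟨h1, h2, h3, h4⟩ := hS.2 p hp p' hp' hpp
    rcases permPair_eq_or τ p with e | e <;> rcases permPair_eq_or τ p' with e' | e' <;>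
      rw [e, e'] <;> simp [h1, h2, h3, h4]

theorem image_permPair_image_permPair {n : ℕ} {S : Finset (Fin n × Fin n)} (hS : isSIF S)
    {τ : Equiv.Perm (Fin n)} (hτ : Function.Involutive τ) :
    (S.image (permPair τ)).image (permPair τ) = S := by
  rw [Finset.image_image]
  conv_rhs => rw [← Finset.image_id (s := S)]
  exact Finset.image_congr fun q hq => permPair_permPair hτ (hS.1 q hq)

theorem injOn_permPair {n : ℕ} {S : Finset (Fin n × Fin n)} (hS : isSIF S)
    {τ : Equiv.Perm (Fin n)} (hτ : Function.Involutive τ) :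
    Set.InjOn (permPair τ) (S : Set (Fin n × Fin n)) :=
  Set.LeftInvOn.injOn (f₁' := permPair τ) fun q hq => permPair_permPair hτ (hS.1 q hq)

theorem bijOn_image_permPair {n : ℕ} {τ : Equiv.Perm (Fin n)} (hτ : Function.Involutive τ)
    {e e' : Fin n × Fin n} (he : permPair τ e = e') (he' : permPair τ e' = e) :
    Set.BijOn (fun S : Finset (Fin n × Fin n) => S.image (permPair τ))
      {S | isSIF S ∧ e ∈ S} {S | isSIF S ∧ e' ∈ S} := by
  refine Set.InvOn.bijOn (f' := fun S => S.image (permPair τ)) ⟨?_, ?_⟩ ?_ ?_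
  · exact fun S hS => image_permPair_image_permPair hS.1 hτ
  · exact fun S hS => image_permPair_image_permPair hS.1 hτ
  · exact fun S hS => ⟨hS.1.image_permPair τ, Finset.mem_image.2 ⟨e, hS.2, he⟩⟩
  · exact fun S hS => ⟨hS.1.image_permPair τ, Finset.mem_image.2 ⟨e', hS.2, he'⟩⟩

/-- A strictly monotone relabelling commutes with sorting. -/
theorem sort_image_of_strictMonoOn {α β : Type*} [LinearOrder α] [LinearOrder β] {f : α → β}
    {s : Finset α} (hf : StrictMonoOn f (s : Set α)) :
    (s.image f).sort (· ≤ ·) = (s.sort (· ≤ ·)).map f := by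
  refine List.Perm.eq_of_pairwise' (r := (· ≤ ·)) (Finset.pairwise_sort _ _) ?_ ?_
  · refine List.pairwise_map.2 ((Finset.pairwise_sort s (· ≤ ·)).imp_of_mem ?_)
    intro a b ha hb hab
    exact hf.monotoneOn (by simpa using ha) (by simpa using hb) hab
  · refine (List.perm_ext_iff_of_nodup (Finset.sort_nodup _ _) ?_).2 ?_
    · refine List.Nodup.map_on ?_ (Finset.sort_nodup _ _)
      intro a ha b hb hab
      exact hf.injOn (by simpa using ha) (by simpa using hb) hab
    · simp

theorem neg_one_pow_crossNum {n : ℕ} (S : Finset (Fin n × Fin n)) :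
    (-1 : ℂ) ^ crossNum S = ∏ x ∈ S, ∏ y ∈ S,
      if x.1 < y.1 ∧ y.1 < x.2 ∧ x.2 < y.2 then -1 else 1 := by
  rw [← Finset.prod_product', ← Finset.prod_filter, Finset.prod_const, crossNum]
  congr 2
  refine Finset.filter_congr fun z _ => ?_
  unfold crosses
  constructor
  · rintro ⟨h, h' | h'⟩
    · exact h'
    · exact absurd h h'.1.not_gt
  · exact fun h => ⟨h.1, Or.inl h⟩

theorem swap_involutive {α : Type*} [DecidableEq α] (a b : α) :
    Function.Involutive (Equiv.swap a b) := fun x => by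
  rw [← Equiv.Perm.mul_apply, Equiv.swap_mul_self, Equiv.Perm.one_apply]

section AdjacentSwap

variable {n : ℕ} {k k' z : Fin n} {S : Finset (Fin n × Fin n)}

theorem swap_lt_swap_of_lt (hk : (k' : ℕ) + 1 = k) {a b : Fin n} (hab : a < b)
    (h : ¬(a = k' ∧ b = k)) : Equiv.swap k k' a < Equiv.swap k k' b := by
  simp only [Equiv.swap_apply_def]
  split_ifs <;> grind

theorem swap_lt_swap_iff_of_ne (hk : (k' : ℕ) + 1 = k) {a b : Fin n} (ha : a ≠ k) (hb : b ≠ k) :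
    Equiv.swap k k' a < Equiv.swap k k' b ↔ a < b := by
  refine ⟨fun h => ?_, fun h => swap_lt_swap_of_lt hk h fun h' => hb h'.2⟩
  by_contra hab
  rcases (not_lt.1 hab).eq_or_lt with rfl | hba
  · exact lt_irrefl _ h
  · exact h.not_gt (swap_lt_swap_of_lt hk hba fun h' => ha h'.2)

theorem isSIF.ne_of_mem (hS : isSIF S) (hz : (z, k) ∈ S) {q : Fin n × Fin n} (hq : q ∈ S)
    (hne : q ≠ (z, k)) : q.1 ≠ z ∧ q.1 ≠ k ∧ q.2 ≠ z ∧ q.2 ≠ k :=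
  hS.2 q hq _ hz hne

theorem permPair_swap_eq (hk : (k' : ℕ) + 1 = k) (hzk : z < k') (hS : isSIF S)
    (hz : (z, k) ∈ S) {q : Fin n × Fin n} (hq : q ∈ S) :
    permPair (Equiv.swap k k') q = (Equiv.swap k k' q.1, Equiv.swap k k' q.2) := by
  refine if_pos (swap_lt_swap_of_lt hk (hS.1 q hq) ?_)
  rintro ⟨h1, h2⟩
  by_cases h : q = (z, k)
  · subst h
    exact hzk.ne h1
  · exact (hS.ne_of_mem hz hq h).2.2.2 h2

theorem pCount_image_permPair (hk : (k' : ℕ) + 1 = k) (hzk : z < k') (hS : isSIF S)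
    (hz : (z, k) ∈ S) (I : Fin n → Fin 5 × Fin 5) :
    pCount (fun a => I (Equiv.swap k k' a)) (S.image (permPair (Equiv.swap k k')))
      = pCount I S := by
  funext t
  unfold pCount
  rw [Finset.filter_image, Finset.card_image_of_injOn]
  · congr 1
    refine Finset.filter_congr fun q hq => ?_
    rw [permPair_swap_eq hk hzk hS hz hq]
    simp
  · exact (injOn_permPair hS (swap_involutive k k')).mono
      (Finset.coe_subset.2 (Finset.filter_subset _ _))

theorem dRest_image_permPair {A : Type*} [Ring A] (dd : Fin 5 → Fin 5 → A)
    (hk : (k' : ℕ) + 1 = k) (hzk : z < k') (hS : isSIF S) (hz : (z, k) ∈ S)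
    (I : Fin n → Fin 5 × Fin 5) :
    dRest dd (fun a => I (Equiv.swap k k' a)) (S.image (permPair (Equiv.swap k k')))
      = dRest dd I S := by
  have hmono : StrictMonoOn (Equiv.swap k k')
      ((Finset.univ.filter fun i : Fin n => ∀ q ∈ S, i ≠ q.1 ∧ i ≠ q.2 : Finset (Fin n)) :
        Set (Fin n)) := by
    intro a _ b hb hab
    have hb' := (Finset.mem_filter.1 (Finset.mem_coe.1 hb)).2 _ hz
    exact swap_lt_swap_of_lt hk hab fun h => hb'.2 h.2
  have himage : (Finset.univ.filter fun i : Fin n =>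
      ∀ q ∈ S.image (permPair (Equiv.swap k k')), i ≠ q.1 ∧ i ≠ q.2)
      = (Finset.univ.filter fun i : Fin n => ∀ q ∈ S, i ≠ q.1 ∧ i ≠ q.2).image
        (Equiv.swap k k') := by
    ext i
    have hi : ∀ j, i = Equiv.swap k k' j ↔ Equiv.swap k k' i = j := fun j => by
      rw [← Equiv.symm_apply_eq, Equiv.symm_swap]
    simp only [Finset.mem_filter, Finset.mem_univ, true_and, Finset.forall_mem_image]
    rw [Finset.mem_image]
    simp only [Finset.mem_filter, Finset.mem_univ, true_and]
    constructor
    · intro h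
      refine ⟨Equiv.swap k k' i, fun q hq => ?_, swap_involutive k k' i⟩
      have := h hq
      rw [permPair_swap_eq hk hzk hS hz hq] at this
      simpa only [ne_eq, hi] using this
    · rintro ⟨j, hj, rfl⟩ q hq
      rw [permPair_swap_eq hk hzk hS hz hq]
      simpa using hj q hq
  unfold dRest
  rw [himage, sort_image_of_strictMonoOn hmono, List.map_map]
  simp [Function.comp_def]

theorem DScalar_image_permPair (hk : (k' : ℕ) + 1 = k) (hzk : z < k') (hS : isSIF S)
    (hz : (z, k) ∈ S) (I : Fin n → Fin 5 × Fin 5) :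
    DScalar (fun a => I (Equiv.swap k k' a)) (S.image (permPair (Equiv.swap k k')))
      = -(∏ q ∈ S, if q.1 = k' ∨ q.2 = k' then (-1 : ℂ) else 1) * DScalar I S := by
  have hneg : -(∏ q ∈ S, if q.1 = k' ∨ q.2 = k' then (-1 : ℂ) else 1)
      = (∏ q ∈ S, if q = (z, k) then (-1 : ℂ) else 1) *
        ∏ q ∈ S, if q.1 = k' ∨ q.2 = k' then (-1 : ℂ) else 1 := by
    rw [Finset.prod_ite_eq' S (z, k) fun _ => (-1 : ℂ), if_pos hz, neg_one_mul]
  rw [hneg]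
  unfold DScalar
  rw [Finset.prod_image (injOn_permPair hS (swap_involutive k k')),
    ← Finset.prod_mul_distrib, ← Finset.prod_mul_distrib]
  refine Finset.prod_congr rfl fun q hq => ?_
  rw [permPair_swap_eq hk hzk hS hz hq]
  simp only [swap_involutive k k' q.1, swap_involutive k k' q.2]
  have hkz : z < k := hzk.trans (Fin.lt_def.2 (by omega))
  by_cases hqe : q = (z, k)
  · subst hqe
    have h1 : ¬(z = k' ∨ k = k') := by grind
    simp only [if_neg h1, if_true, Equiv.swap_apply_left,
      Equiv.swap_apply_of_ne_of_ne hkz.ne hzk.ne, ← hk]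
    ring
  · obtain ⟨-, h1, -, h2⟩ := hS.ne_of_mem hz hq hqe
    have hlt := hS.1 q hq
    rw [if_neg hqe]
    by_cases hq1 : q.1 = k'
    · have hq2 : q.2 ≠ k' := fun h => hlt.ne (hq1.trans h.symm)
      rw [if_pos (Or.inl hq1), Equiv.swap_apply_of_ne_of_ne h2 hq2, hq1,
        Equiv.swap_apply_right, ← hk]
      ring
    · by_cases hq2 : q.2 = k'
      · rw [if_pos (Or.inr hq2), Equiv.swap_apply_of_ne_of_ne h1 hq1, hq2,
          Equiv.swap_apply_right, ← hk]
        ring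
      · rw [if_neg (not_or.2 ⟨hq1, hq2⟩), Equiv.swap_apply_of_ne_of_ne h1 hq1,
          Equiv.swap_apply_of_ne_of_ne h2 hq2]
        ring

theorem neg_one_pow_crossNum_image_permPair (hk : (k' : ℕ) + 1 = k) (hzk : z < k')
    (hz0 : (z : ℕ) = 0) (hS : isSIF S) (hz : (z, k) ∈ S) :
    (-1 : ℂ) ^ crossNum (S.image (permPair (Equiv.swap k k')))
      = (∏ q ∈ S, if q.1 = k' ∨ q.2 = k' then (-1 : ℂ) else 1) * (-1 : ℂ) ^ crossNum S := by
  have hprod : (∏ q ∈ S, if q.1 = k' ∨ q.2 = k' then (-1 : ℂ) else 1)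
      = ∏ x ∈ S, ∏ y ∈ S, if x = (z, k) ∧ (y.1 = k' ∨ y.2 = k') then (-1 : ℂ) else 1 := by
    refine ((Finset.prod_eq_single_of_mem (z, k) hz fun x _ hx => ?_).trans ?_).symm
    · exact Finset.prod_eq_one fun y _ => if_neg fun h => hx h.1
    · simp only [true_and]
  rw [hprod, neg_one_pow_crossNum, neg_one_pow_crossNum, ← Finset.prod_mul_distrib,
    Finset.prod_image (injOn_permPair hS (swap_involutive k k'))]
  refine Finset.prod_congr rfl fun x hx => ?_
  rw [← Finset.prod_mul_distrib,
    Finset.prod_image (injOn_permPair hS (swap_involutive k k'))]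
  refine Finset.prod_congr rfl fun y hy => ?_
  rw [permPair_swap_eq hk hzk hS hz hx, permPair_swap_eq hk hzk hS hz hy]
  have hkz : z < k := hzk.trans (Fin.lt_def.2 (by omega))
  have hswap_z : Equiv.swap k k' z = z := Equiv.swap_apply_of_ne_of_ne hkz.ne hzk.ne
  have hmin : ∀ a, ¬a < z := fun a h => by
    have := Fin.lt_def.1 h
    omega
  by_cases hxe : x = (z, k)
  · subst hxe
    by_cases hye : y = (z, k)
    · subst hye
      have h1 : ¬(z = k' ∨ k = k') := by grind
      simp [h1]
    · obtain ⟨h1, h2, h3, h4⟩ := hS.ne_of_mem hz hy hye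
      have hlt := hS.1 y hy
      simp only [hswap_z, Equiv.swap_apply_left, true_and]
      simp only [Equiv.swap_apply_def]
      grind
  · obtain ⟨-, h1, -, h2⟩ := hS.ne_of_mem hz hx hxe
    simp only [hxe, false_and, if_false, one_mul]
    by_cases hye : y = (z, k)
    · subst hye
      simp only [hswap_z, hmin, false_and]
    · obtain ⟨-, h3, -, h4⟩ := hS.ne_of_mem hz hy hye
      simp only [swap_lt_swap_iff_of_ne hk h1 h3, swap_lt_swap_iff_of_ne hk h3 h2,
        swap_lt_swap_iff_of_ne hk h2 h4]

end AdjacentSwap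

/-- Swapping the positions `k-1` and `k` (with `3 ≤ k ≤ d`, `1`-based; here `0`-based with
`2 ≤ k`) gives a bijection between the SIF sets containing `{1,k}` and those containing
`{1,k-1}`, under which `d_{C_S(I)} = d_{C_{S'}(J)}` and `(-1)^{c(S)} D_S(I) = -(-1)^{c(S')} D_{S'}(J)`,
where `J` is obtained from `I` by exchanging the entries `I_{k-1}` and `I_k`. -/
theorem sif_swap_bijection {A : Type*} [Ring A] [Algebra ℂ A] (R : E510Rep A)
    (d : ℕ) (hd : 3 ≤ d) (k : Fin d) (hk : 2 ≤ (k : ℕ)) (I : Fin d → Fin 5 × Fin 5) :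
    let k' : Fin d := ⟨(k : ℕ) - 1, by have := k.isLt; omega⟩
    let τ : Equiv.Perm (Fin d) := Equiv.swap k k'
    let pairSwap : Fin d × Fin d → Fin d × Fin d :=
      fun q => if τ q.1 < τ q.2 then (τ q.1, τ q.2) else (τ q.2, τ q.1)
    let J : Fin d → Fin 5 × Fin 5 := fun a => I (τ a)
    let z : Fin d := ⟨0, by omega⟩
    Set.BijOn (fun S : Finset (Fin d × Fin d) => S.image pairSwap)
        {S | isSIF S ∧ (z, k) ∈ S} {S | isSIF S ∧ (z, k') ∈ S}
      ∧ ∀ S : Finset (Fin d × Fin d), isSIF S → (z, k) ∈ S →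
          dRest R.d I S = dRest R.d J (S.image pairSwap)
            ∧ ((-1 : ℂ) ^ crossNum S * DScalar I S) • pMono R.p (pCount I S)
              = -(((-1 : ℂ) ^ crossNum (S.image pairSwap) * DScalar J (S.image pairSwap)) •
                  pMono R.p (pCount J (S.image pairSwap))) := by
  intro k' τ pairSwap J z
  have hkk : (k' : ℕ) + 1 = k := Nat.sub_add_cancel (by omega)
  have hzk : z < k' := Fin.mk_lt_mk.2 (by omega)
  have hzk2 : z < k := Fin.lt_def.2 (by show 0 < (k : ℕ); omega)
  have hτz : τ z = z := Equiv.swap_apply_of_ne_of_ne hzk2.ne hzk.ne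
  have hτ : Function.Involutive τ := swap_involutive k k'
  refine ⟨bijOn_image_permPair hτ ?_ ?_, fun S hS hz => ⟨?_, ?_⟩⟩
  · simp [permPair, hτz, τ, hzk]
  · simp [permPair, hτz, τ, hzk2]
  · exact (dRest_image_permPair R.d hkk hzk hS hz I).symm
  · have hcount : pCount J (S.image pairSwap) = pCount I S :=
      pCount_image_permPair hkk hzk hS hz I
    have hscalar : DScalar J (S.image pairSwap)
        = -(∏ q ∈ S, if q.1 = k' ∨ q.2 = k' then (-1 : ℂ) else 1) * DScalar I S :=
      DScalar_image_permPair hkk hzk hS hz I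
    have hcross : (-1 : ℂ) ^ crossNum (S.image pairSwap)
        = (∏ q ∈ S, if q.1 = k' ∨ q.2 = k' then (-1 : ℂ) else 1) * (-1 : ℂ) ^ crossNum S :=
      neg_one_pow_crossNum_image_permPair hkk hzk rfl hS hz
    have hsq : (∏ q ∈ S, if q.1 = k' ∨ q.2 = k' then (-1 : ℂ) else 1) *
        (∏ q ∈ S, if q.1 = k' ∨ q.2 = k' then (-1 : ℂ) else 1) = 1 := by
      rw [← Finset.prod_mul_distrib]
      exact Finset.prod_eq_one fun q _ => by split_ifs <;> norm_num
    rw [hcount, hscalar, hcross, ← neg_smul]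
    congr 1
    linear_combination (-1 : ℂ) ^ crossNum S * DScalar I S * -hsq

end
end
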